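/- arXiv:2301.12327 — 2 statements merged into one kernel-verified Lean document; each statement's English description precedes it below -/
import Mathlib

section
/- Let x̂ solve the Stampacchia quasivariational inequality SVIP(N_0, K), where N_0(x) := ∏_ν (N_ν(x) \ {0}). Assume that for each player ν the constraint map K_ν has nonempty values and that U^s_ν(x) is an open subset of ℝ^{n_ν} for every x ∈ ℝⁿ. Then x̂ is a generalized Nash equilibrium. -/
open RealInnerProductSpace

noncomputable section

/-- The asymmetric (strict) part of a binary relation. -/
def strictPart {α : Type*} (r : α → α → Prop) (x y : α) : Prop := r x y ∧ ¬ r y x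

/-- The preferred set `U^s_ν(x) = {y^ν : (y^ν, x^{-ν}) ≻_ν x}`. -/
def Us {ι : Type*} [DecidableEq ι] (n : ι → ℕ)
    (pref : ι → (∀ μ, EuclideanSpace ℝ (Fin (n μ))) → (∀ μ, EuclideanSpace ℝ (Fin (n μ))) → Prop)
    (ν : ι) (x : ∀ μ, EuclideanSpace ℝ (Fin (n μ))) : Set (EuclideanSpace ℝ (Fin (n ν))) :=
  {y | strictPart (pref ν) (Function.update x ν y) x}

/-- The normal cone `𝒩_A(x)`; note that this set-builder description equals the whole
space when `A = ∅`, matching the paper's convention. -/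
def normalCone {m : ℕ} (A : Set (EuclideanSpace ℝ (Fin m))) (x : EuclideanSpace ℝ (Fin m)) :
    Set (EuclideanSpace ℝ (Fin m)) :=
  {xs | ∀ y ∈ A, ⟪xs, y - x⟫ ≤ 0}

/-- The normal cone map `N_ν(x) := 𝒩_{U^s_ν(x)}(x^ν)`. -/
def Nmap {ι : Type*} [DecidableEq ι] (n : ι → ℕ)
    (pref : ι → (∀ μ, EuclideanSpace ℝ (Fin (n μ))) → (∀ μ, EuclideanSpace ℝ (Fin (n μ))) → Prop)
    (ν : ι) (x : ∀ μ, EuclideanSpace ℝ (Fin (n μ))) : Set (EuclideanSpace ℝ (Fin (n ν))) :=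
  normalCone (Us n pref ν x) (x ν)

/-- A nonzero normal vector to an open set is strictly negative on it. -/
theorem inner_neg_of_mem_normalCone {m : ℕ} {A : Set (EuclideanSpace ℝ (Fin m))}
    (hA : IsOpen A) {x y v : EuclideanSpace ℝ (Fin m)} (hv : v ∈ normalCone A x) (hv0 : v ≠ 0)
    (hy : y ∈ A) : ⟪v, y - x⟫ < 0 := by
  have hcont : Continuous fun t : ℝ => y + t • v := by fun_prop
  have hnhds : ∀ᶠ t : ℝ in nhdsWithin 0 (Set.Ioi 0), y + t • v ∈ A :=
    (hcont.continuousAt.eventually_mem (hA.mem_nhds (by simpa using hy))).filter_mono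
      nhdsWithin_le_nhds
  obtain ⟨t, htA, ht⟩ := (hnhds.and self_mem_nhdsWithin).exists
  have hle : ⟪v, y + t • v - x⟫ ≤ 0 := hv _ htA
  rw [add_sub_right_comm, inner_add_right, real_inner_smul_right] at hle
  have hpos : 0 < t * ⟪v, v⟫ := mul_pos ht (real_inner_self_pos.2 hv0)
  linarith

/-- Theorem 1: any solution of the Stampacchia quasivariational
inequality `SVIP(N₀, K)`, where `N₀(x) = ∏_ν (N_ν(x) \ {0})`, is a generalized Nash
equilibrium, provided each `K_ν` has nonempty values and each `U^s_ν(x)` is open. -/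
theorem svip_solution_is_GNE
    {ι : Type*} [Fintype ι] [Nonempty ι] [DecidableEq ι]
    (n : ι → ℕ) (hn : ∀ ν, 1 ≤ n ν)
    (pref : ι → (∀ μ, EuclideanSpace ℝ (Fin (n μ))) → (∀ μ, EuclideanSpace ℝ (Fin (n μ))) → Prop)
    (X : ∀ ν, Set (EuclideanSpace ℝ (Fin (n ν)))) (hX : ∀ ν, (X ν).Nonempty)
    (K : ∀ ν : ι, (∀ μ, EuclideanSpace ℝ (Fin (n μ))) → Set (EuclideanSpace ℝ (Fin (n ν))))
    (hKX : ∀ ν x, K ν x ⊆ X ν)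
    -- `K_ν` depends only on the rivals' strategies
    (hKriv : ∀ ν x x', (∀ μ, μ ≠ ν → x μ = x' μ) → K ν x = K ν x')
    -- assumption 1: `K_ν` is nonempty valued
    (hKne : ∀ ν x, (K ν x).Nonempty)
    -- assumption 2: `U^s_ν(x)` is open for all `x`
    (hUopen : ∀ ν x, IsOpen (Us n pref ν x))
    -- `xhat` solves `SVIP(N₀, K)`:
    (xhat : ∀ μ, EuclideanSpace ℝ (Fin (n μ)))
    (hfeas : ∀ ν, xhat ν ∈ K ν xhat)
    (xs : ∀ μ, EuclideanSpace ℝ (Fin (n μ)))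
    (hxs : ∀ ν, xs ν ∈ Nmap n pref ν xhat \ {0})
    (hineq : ∀ y : ∀ μ, EuclideanSpace ℝ (Fin (n μ)),
      (∀ ν, y ν ∈ K ν xhat) → 0 ≤ ∑ ν, ⟪xs ν, y ν - xhat ν⟫) :
    -- `xhat` is a generalized Nash equilibrium
    (∀ ν, xhat ν ∈ K ν xhat) ∧ ∀ ν, Us n pref ν xhat ∩ K ν xhat = ∅ := by
  refine ⟨hfeas, fun ν => Set.eq_empty_iff_forall_notMem.2 ?_⟩
  rintro y ⟨hyU, hyK⟩
  have hneg := inner_neg_of_mem_normalCone (hUopen ν xhat) (hxs ν).1 (hxs ν).2 hyU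
  have hnonneg := hineq (Function.update xhat ν y) fun μ => by
    rcases eq_or_ne μ ν with rfl | hμ
    · simpa using hyK
    · simpa [hμ] using hfeas μ
  rw [Finset.sum_eq_single ν (fun μ _ hμ => by simp [hμ]) (by simp),
    Function.update_self] at hnonneg
  exact hneg.not_ge hnonneg
end
end

section
/- Let A ⊆ ℝ^m be a nonempty open set and let x ∈ ℝ^m. Then 0 does not belong to the convex hull of 𝒩_A(x) ∩ S(0,1); equivalently, there do not exist x*_1, …, x*_k ∈ 𝒩_A(x) with ‖x*_i‖ = 1 and t_1, …, t_k ∈ [0,1] with ∑ t_i = 1 and ∑ t_i x*_i = 0. -/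
open RealInnerProductSpace

/-- A unit normal to an open set `A` has strictly negative inner product with `a - x`
for every `a ∈ A`. -/
theorem inner_sub_neg_of_mem_normalCone {m : ℕ} {A : Set (EuclideanSpace ℝ (Fin m))}
    (hA : IsOpen A) {x a v : EuclideanSpace ℝ (Fin m)} (ha : a ∈ A)
    (hv : v ∈ normalCone A x) (hv1 : ‖v‖ = 1) : ⟪v, a - x⟫ < 0 := by
  obtain ⟨ε, hε, hball⟩ := Metric.isOpen_iff.mp hA a ha
  have hmem : a + (ε / 2) • v ∈ A := by
    apply hball
    rw [Metric.mem_ball, dist_self_add_left, norm_smul, hv1, Real.norm_of_nonneg (by positivity)]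
    linarith
  have h := hv _ hmem
  rw [add_sub_right_comm, inner_add_right, inner_smul_right, real_inner_self_eq_norm_sq, hv1] at h
  linarith

/-- a step in Theorem 3: if `A ⊆ ℝ^m` is a nonempty open set and
`x ∈ ℝ^m`, then `0` does not belong to the convex hull of `𝒩_A(x) ∩ S(0,1)`. -/
theorem zero_not_mem_convexHull_normalCone_inter_sphere
    {m : ℕ} (A : Set (EuclideanSpace ℝ (Fin m))) (hAne : A.Nonempty) (hAopen : IsOpen A)
    (x : EuclideanSpace ℝ (Fin m)) :
    (0 : EuclideanSpace ℝ (Fin m)) ∉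
      convexHull ℝ (normalCone A x ∩ Metric.sphere (0 : EuclideanSpace ℝ (Fin m)) 1) := by
  intro h0
  obtain ⟨a, ha⟩ := hAne
  have hsub : normalCone A x ∩ Metric.sphere 0 1 ⊆ {v | ⟪a - x, v⟫ < 0} := by
    rintro v ⟨hv, hv1⟩
    rw [Set.mem_ofPred_eq, real_inner_comm]
    exact inner_sub_neg_of_mem_normalCone hAopen ha hv (mem_sphere_zero_iff_norm.mp hv1)
  have hconv : Convex ℝ {v : EuclideanSpace ℝ (Fin m) | ⟪a - x, v⟫ < 0} :=
    convex_halfSpace_lt (innerₛₗ ℝ (a - x)).isLinear 0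
  simpa using convexHull_min hsub hconv h0
end
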